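/- arXiv:2305.06614 — 6 statements merged into one kernel-verified Lean document; each statement's English description precedes it below -/
import Mathlib

section
/- (Proposition 1, asymptotic case.) Let β, β_x, β_w : ℝ≥0 → ℝ≥0 be of class K∞, let η ∈ (0,1), let a ≥ 0, let 𝒯 ⊆ ℝ≥0, let e : ℝ≥0 → ℝ≥0, and let w : ℝ≥0 → ℝ^q be measurable and essentially bounded on every bounded interval. Suppose that for all t ∈ 𝒯, β(e(t)) ≤ β_x(a)·η^t + ∫₀^t η^{t−τ} β_w(|w(τ)|) dτ. Then for all t ∈ 𝒯, e(t) ≤ max{ β⁻¹(2 β_x(a) η^t), β⁻¹((−2/ln η) · β_w(ess sup_{τ∈[0,t]} |w(τ)|)) }, where β⁻¹ is the inverse of β on ℝ≥0. -/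
open MeasureTheory Set

/-- A function `α : ℝ≥0 → ℝ≥0` (modeled on `Ici 0 ⊆ ℝ`) is of class `K∞`:
continuous, strictly increasing, `α 0 = 0`, and unbounded. -/
def IsKInfinity (α : ℝ → ℝ) : Prop :=
  ContinuousOn α (Set.Ici 0) ∧ StrictMonoOn α (Set.Ici 0) ∧ α 0 = 0 ∧
    ∀ M : ℝ, ∃ s, 0 ≤ s ∧ M < α s

theorem IsKInfinity.nonneg {α : ℝ → ℝ} (h : IsKInfinity α) {s : ℝ} (hs : 0 ≤ s) : 0 ≤ α s := by
  obtain ⟨-, hm, h0, -⟩ := h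
  rw [← h0]
  exact hm.monotoneOn self_mem_Ici hs hs

theorem IsKInfinity.exists_eq {α : ℝ → ℝ} (h : IsKInfinity α) {y : ℝ} (hy : 0 ≤ y) :
    ∃ s, 0 ≤ s ∧ α s = y := by
  obtain ⟨hc, -, h0, hu⟩ := h
  obtain ⟨b, hb, hyb⟩ := hu y
  obtain ⟨s, hs, rfl⟩ := intermediate_value_Icc hb (hc.mono Icc_subset_Ici_self)
    ⟨h0.le.trans hy, hyb.le⟩
  exact ⟨s, hs.1, rfl⟩

theorem integral_rpow_sub_le {η : ℝ} (hη : η ∈ Ioo (0 : ℝ) 1) (t : ℝ) :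
    ∫ τ in (0 : ℝ)..t, η ^ (t - τ) ≤ -1 / Real.log η := by
  have hlog : Real.log η < 0 := Real.log_neg hη.1 hη.2
  have hderiv : ∀ τ ∈ uIcc 0 t,
      HasDerivAt (fun τ => -(η ^ (t - τ)) / Real.log η) (η ^ (t - τ)) τ := by
    intro τ _
    have h := ((((hasDerivAt_id τ).const_sub t).const_rpow hη.1).neg).div_const (Real.log η)
    refine h.congr_deriv ?_
    have := hlog.ne
    simp only [id]
    field_simp
  have hcont : Continuous fun τ : ℝ => η ^ (t - τ) :=
    Continuous.rpow continuous_const (by fun_prop) fun _ => Or.inl hη.1.ne'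
  rw [intervalIntegral.integral_eq_sub_of_hasDerivAt hderiv (hcont.intervalIntegrable _ _)]
  simp only [sub_self, Real.rpow_zero, sub_zero]
  have : 0 < η ^ t := Real.rpow_pos_of_pos hη.1 t
  rw [← sub_div]
  exact div_le_div_of_nonpos_of_le hlog.le (by linarith)

/-- Discounted integrals of a function essentially bounded by `c` are at most `c / (-log η)`. -/
theorem integral_rpow_sub_mul_le {η : ℝ} (hη : η ∈ Ioo (0 : ℝ) 1) {t c : ℝ} (ht : 0 ≤ t)
    (hc : 0 ≤ c) {f : ℝ → ℝ} (hf : ∀ τ, 0 ≤ f τ)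
    (hfc : ∀ᵐ τ ∂(volume.restrict (Icc 0 t)), f τ ≤ c) :
    ∫ τ in (0 : ℝ)..t, η ^ (t - τ) * f τ ≤ -1 / Real.log η * c := by
  have hcont : Continuous fun τ : ℝ => η ^ (t - τ) * c :=
    (Continuous.rpow continuous_const (by fun_prop) fun _ => Or.inl hη.1.ne').mul_const c
  have hmono : ∫ τ in (0 : ℝ)..t, η ^ (t - τ) * f τ ≤ ∫ τ in (0 : ℝ)..t, η ^ (t - τ) * c := by
    rw [intervalIntegral.integral_of_le ht, intervalIntegral.integral_of_le ht]
    refine integral_mono_of_nonneg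
      (.of_forall fun τ => mul_nonneg (Real.rpow_nonneg hη.1.le _) (hf τ))
      (hcont.integrableOn_Icc.mono_set Ioc_subset_Icc_self) ?_
    filter_upwards [ae_restrict_of_ae_restrict_of_subset Ioc_subset_Icc_self hfc] with τ hτ
    exact mul_le_mul_of_nonneg_left hτ (Real.rpow_nonneg hη.1.le _)
  rw [intervalIntegral.integral_mul_const] at hmono
  exact hmono.trans (mul_le_mul_of_nonneg_right (integral_rpow_sub_le hη t) hc)

/-- For `t = 0` the measure is zero and the real-valued essential supremum is `0` by convention. -/
theorem essSup_Icc_nonneg {f : ℝ → ℝ} (hf : ∀ τ, 0 ≤ f τ) {t : ℝ} (ht : 0 ≤ t)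
    (hle : ∀ᵐ τ ∂(volume.restrict (Icc 0 t)), f τ ≤ essSup f (volume.restrict (Icc 0 t))) :
    0 ≤ essSup f (volume.restrict (Icc 0 t)) := by
  rcases ht.eq_or_lt with rfl | ht
  · simp [essSup_eq_sInf]
  · have : Filter.NeBot (ae (volume.restrict (Icc 0 t))) := by
      rw [ae_neBot, Ne, Measure.restrict_eq_zero]
      simp [ht]
    obtain ⟨τ, hτ⟩ := hle.exists
    exact (hf τ).trans hτ

/-- Proposition 1, asymptotic case: a time-discounted `L²`-to-`L∞`
RGAS bound implies the corresponding sup-norm (`L∞`-to-`L∞`) bound. -/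
theorem rgas_implies_sup_bound {q : ℕ}
    (β βx βw : ℝ → ℝ)
    (hβ : IsKInfinity β) (hβx : IsKInfinity βx) (hβw : IsKInfinity βw)
    (η : ℝ) (hη : η ∈ Set.Ioo (0:ℝ) 1)
    (a : ℝ) (ha : 0 ≤ a)
    (𝒯 : Set ℝ) (h𝒯 : 𝒯 ⊆ Set.Ici 0)
    (e : ℝ → ℝ) (he : ∀ t, 0 ≤ e t)
    (w : ℝ → EuclideanSpace ℝ (Fin q)) (hw : Measurable w)
    (hwb : ∀ r, 0 ≤ r → ∃ C : ℝ, ∀ᵐ τ ∂(volume.restrict (Set.Icc 0 r)), ‖w τ‖ ≤ C)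
    (hbound : ∀ t ∈ 𝒯,
      β (e t) ≤ βx a * η ^ t + ∫ τ in (0:ℝ)..t, η ^ (t - τ) * βw ‖w τ‖)
    (βinv : ℝ → ℝ)
    (hβinv : ∀ s, 0 ≤ s → βinv (β s) = s ∧ β (βinv s) = s) :
    ∀ t ∈ 𝒯,
      e t ≤ max (βinv (2 * βx a * η ^ t))
        (βinv ((-2 / Real.log η) *
          βw (essSup (fun τ => ‖w τ‖) (volume.restrict (Set.Icc 0 t))))) := by
  intro t htT
  have ht : 0 ≤ t := h𝒯 htT
  have hlog : Real.log η < 0 := Real.log_neg hη.1 hη.2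
  set M := essSup (fun τ => ‖w τ‖) (volume.restrict (Set.Icc 0 t))
  have hle : ∀ᵐ τ ∂(volume.restrict (Icc 0 t)), ‖w τ‖ ≤ M := by
    obtain ⟨C, hC⟩ := hwb t ht
    exact ae_le_essSup ⟨C, hC⟩
  have hM0 : 0 ≤ M := essSup_Icc_nonneg (fun _ => norm_nonneg _) ht hle
  have hI := integral_rpow_sub_mul_le hη ht (hβw.nonneg hM0)
    (fun τ => hβw.nonneg (norm_nonneg (w τ)))
    (hle.mono fun τ hτ => hβw.2.1.monotoneOn (norm_nonneg _) hM0 hτ)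
  have hle_inv : ∀ {y}, 0 ≤ y → β (e t) ≤ y → e t ≤ βinv y := by
    intro y hy h
    obtain ⟨s, hs, rfl⟩ := hβ.exists_eq hy
    rw [(hβinv s hs).1]
    exact (hβ.2.1.le_iff_le (he t) hs).1 h
  have hA : 0 ≤ βx a * η ^ t := mul_nonneg (hβx.nonneg ha) (Real.rpow_nonneg hη.1.le t)
  have hB : 0 ≤ -1 / Real.log η * βw M :=
    mul_nonneg (div_nonneg_of_nonpos (by norm_num) hlog.le) (hβw.nonneg hM0)
  have hsum := (hbound t htT).trans (add_le_add_right hI _)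
  have hB2 : -2 / Real.log η * βw M = 2 * (-1 / Real.log η * βw M) := by ring
  rw [hB2, mul_assoc]
  rcases le_total (-1 / Real.log η * βw M) (βx a * η ^ t) with h | h
  · exact le_max_of_le_left (hle_inv (by linarith) (by linarith))
  · exact le_max_of_le_right (hle_inv (by linarith) (by linarith))
end

section
/- (Proposition 1, exponential case.) Let β, β_x, β_w : ℝ≥0 → ℝ≥0 be of class K∞, let η ∈ (0,1), let a ≥ 0, let 𝒯 ⊆ ℝ≥0, let e : ℝ≥0 → ℝ≥0, and let w : ℝ≥0 → ℝ^q be measurable and essentially bounded on every bounded interval. Suppose that for all t ∈ 𝒯, β(e(t)) ≤ β_x(a)·η^t + ∫₀^t η^{t−τ} β_w(|w(τ)|) dτ, and additionally that there exist constants C₁, C₂, r > 0 with β(s) ≥ C₁ s^r and β_x(s) ≤ C₂ s^r for all s ≥ 0. Then for all t ∈ 𝒯, e(t) ≤ max{ (2C₂/C₁)^{1/r} · a · (η^{1/r})^t, ((−2/(C₁ ln η)) · β_w(ess sup_{τ∈[0,t]} |w(τ)|))^{1/r} }. -/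
open MeasureTheory Set

/-- The `η`-discounted integral of a constant rate over `[0, t]`. -/
theorem integral_const_rpow_sub {η : ℝ} (h0 : 0 < η) (h1 : η < 1) (t : ℝ) :
    ∫ τ in (0 : ℝ)..t, η ^ (t - τ) = (1 - η ^ t) / (-Real.log η) := by
  have hlog : Real.log η ≠ 0 := (Real.log_neg h0 h1).ne
  have hd : ∀ τ ∈ uIcc 0 t,
      HasDerivAt (fun τ => η ^ (t - τ) / (-Real.log η)) (η ^ (t - τ)) τ := by
    intro τ _
    have h := (((hasDerivAt_id τ).const_sub t).const_rpow h0).div_const (-Real.log η)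
    refine h.congr_deriv ?_
    simp only [id]
    field_simp
  have hc : Continuous fun τ : ℝ => η ^ (t - τ) :=
    continuous_const.rpow (by fun_prop) fun _ => Or.inl h0.ne'
  rw [intervalIntegral.integral_eq_sub_of_hasDerivAt hd (hc.intervalIntegrable _ _)]
  simp only [sub_self, sub_zero, Real.rpow_zero]
  ring

/-- If `f` is bounded above almost everywhere by its real-valued essential supremum and is
nonnegative, the essential supremum is nonnegative, also for the zero measure. -/
theorem essSup_nonneg_of_ae_le {α : Type*} [MeasurableSpace α] {μ : Measure α} {f : α → ℝ}
    (hf : ∀ x, 0 ≤ f x) (hle : ∀ᵐ x ∂μ, f x ≤ essSup f μ) : 0 ≤ essSup f μ := by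
  rcases eq_or_ne μ 0 with rfl | hμ
  · simp [essSup, Filter.limsup_eq]
  · have : (ae μ).NeBot := ae_neBot.2 hμ
    obtain ⟨x, hx⟩ := hle.exists
    exact (hf x).trans hx

/-- A nonnegative number whose `r`-th power satisfies a two-term bound is at most the larger of
the two terms taken separately (each doubled). -/
theorem le_max_rpow_of_mul_rpow_le_add {c r x u v : ℝ} (hc : 0 < c) (hr : 0 < r) (hx : 0 ≤ x)
    (h : c * x ^ r ≤ u + v) : x ≤ max ((2 * u / c) ^ (1 / r)) ((2 * v / c) ^ (1 / r)) := by
  have key : ∀ y, u + v ≤ 2 * y → x ≤ (2 * y / c) ^ (1 / r) := by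
    intro y hy
    have h2 : x ^ r ≤ 2 * y / c := by
      rw [le_div_iff₀ hc]
      linarith
    have hxr : 0 ≤ x ^ r := Real.rpow_nonneg hx r
    rw [one_div, Real.le_rpow_inv_iff_of_pos hx (hxr.trans h2) hr]
    exact h2
  rcases le_total u v with huv | huv
  · exact le_max_of_le_right (key v (by linarith))
  · exact le_max_of_le_left (key u (by linarith))

/-- Proposition 1, exponential case: a time-discounted `L²`-to-`L∞`
RGES bound with power-bounded `β, β_x` implies an exponential sup-norm bound. -/
theorem rges_implies_sup_bound {q : ℕ}
    (β βx βw : ℝ → ℝ)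
    (hβ : IsKInfinity β) (hβx : IsKInfinity βx) (hβw : IsKInfinity βw)
    (η : ℝ) (hη : η ∈ Set.Ioo (0:ℝ) 1)
    (a : ℝ) (ha : 0 ≤ a)
    (𝒯 : Set ℝ) (h𝒯 : 𝒯 ⊆ Set.Ici 0)
    (e : ℝ → ℝ) (he : ∀ t, 0 ≤ e t)
    (w : ℝ → EuclideanSpace ℝ (Fin q)) (hw : Measurable w)
    (hwb : ∀ r, 0 ≤ r → ∃ C : ℝ, ∀ᵐ τ ∂(volume.restrict (Set.Icc 0 r)), ‖w τ‖ ≤ C)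
    (hbound : ∀ t ∈ 𝒯,
      β (e t) ≤ βx a * η ^ t + ∫ τ in (0:ℝ)..t, η ^ (t - τ) * βw ‖w τ‖)
    (C₁ C₂ r : ℝ) (hC₁ : 0 < C₁) (hC₂ : 0 < C₂) (hr : 0 < r)
    (hβlow : ∀ s, 0 ≤ s → C₁ * s ^ r ≤ β s)
    (hβxup : ∀ s, 0 ≤ s → βx s ≤ C₂ * s ^ r) :
    ∀ t ∈ 𝒯,
      e t ≤ max ((2 * C₂ / C₁) ^ (1 / r) * a * (η ^ (1 / r)) ^ t)
        (((-2 / (C₁ * Real.log η)) *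
          βw (essSup (fun τ => ‖w τ‖) (volume.restrict (Set.Icc 0 t)))) ^ (1 / r)) := by
  intro t ht
  have ht0 : 0 ≤ t := h𝒯 ht
  obtain ⟨h0, h1⟩ := hη
  have hlog : Real.log η < 0 := Real.log_neg h0 h1
  set M := essSup (fun τ => ‖w τ‖) (volume.restrict (Icc 0 t)) with hM
  have hle : ∀ᵐ τ ∂(volume.restrict (Icc 0 t)), ‖w τ‖ ≤ M :=
    ae_le_essSup (hwb t ht0)
  have hM0 : 0 ≤ M := essSup_nonneg_of_ae_le (fun τ => norm_nonneg (w τ)) hle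
  have hmono : MonotoneOn βw (Ici 0) := hβw.2.1.monotoneOn
  have hβw_nonneg : ∀ s, 0 ≤ s → 0 ≤ βw s := fun s hs => by
    simpa [hβw.2.2.1] using hmono self_mem_Ici hs hs
  have hint : ∫ τ in (0 : ℝ)..t, η ^ (t - τ) * βw ‖w τ‖ ≤ βw M / (-Real.log η) := by
    have hc : Continuous fun τ : ℝ => η ^ (t - τ) * βw M :=
      (continuous_const.rpow (by fun_prop) fun _ => Or.inl h0.ne').mul continuous_const
    calc ∫ τ in (0 : ℝ)..t, η ^ (t - τ) * βw ‖w τ‖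
        ≤ ∫ τ in (0 : ℝ)..t, η ^ (t - τ) * βw M := by
          rw [intervalIntegral.integral_of_le ht0, intervalIntegral.integral_of_le ht0]
          refine integral_mono_of_nonneg
            (ae_of_all _ fun τ => mul_nonneg (Real.rpow_nonneg h0.le _)
              (hβw_nonneg _ (norm_nonneg _)))
            (hc.intervalIntegrable 0 t).1 ?_
          filter_upwards [ae_restrict_of_ae_restrict_of_subset Ioc_subset_Icc_self hle] with τ hτ
          exact mul_le_mul_of_nonneg_left (hmono (norm_nonneg _) hM0 hτ) (Real.rpow_nonneg h0.le _)
      _ = (1 - η ^ t) * βw M / (-Real.log η) := by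
          rw [intervalIntegral.integral_mul_const, integral_const_rpow_sub h0 h1]
          ring
      _ ≤ βw M / (-Real.log η) := by
          refine div_le_div_of_nonneg_right ?_ (neg_nonneg.2 hlog.le)
          exact mul_le_of_le_one_left (hβw_nonneg _ hM0)
            (by linarith [Real.rpow_nonneg h0.le t])
  have hsum : C₁ * e t ^ r ≤ C₂ * a ^ r * η ^ t + βw M / (-Real.log η) :=
    ((hβlow _ (he t)).trans (hbound t ht)).trans
      (add_le_add (mul_le_mul_of_nonneg_right (hβxup a ha) (Real.rpow_nonneg h0.le t)) hint)
  have hmax := le_max_rpow_of_mul_rpow_le_add hC₁ hr (he t) hsum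
  have hu : (2 * (C₂ * a ^ r * η ^ t) / C₁) ^ (1 / r)
      = (2 * C₂ / C₁) ^ (1 / r) * a * (η ^ (1 / r)) ^ t := by
    have hK : 0 ≤ 2 * C₂ / C₁ := by positivity
    have har : 0 ≤ a ^ r := Real.rpow_nonneg ha r
    rw [show 2 * (C₂ * a ^ r * η ^ t) / C₁ = 2 * C₂ / C₁ * a ^ r * η ^ t by ring,
      Real.mul_rpow (mul_nonneg hK har) (Real.rpow_nonneg h0.le t), Real.mul_rpow hK har,
      ← Real.rpow_mul ha, mul_one_div_cancel hr.ne', Real.rpow_one,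
      ← Real.rpow_mul h0.le, ← Real.rpow_mul h0.le, mul_comm t]
  have hv : 2 * (βw M / (-Real.log η)) / C₁ = -2 / (C₁ * Real.log η) * βw M := by
    have := hlog.ne
    field_simp
  rwa [hu, hv] at hmax
end

section
/- (Core cost bound in the proof of Proposition 2.) Let T > 0, λ ∈ (0,1), and let P₂ ∈ ℝ^{n×n}, Q ∈ ℝ^{q×q}, R ∈ ℝ^{p×p} be symmetric positive definite. Let x₀, x̂₀, χ* ∈ ℝⁿ and let w, w* : [0,T] → ℝ^q and y, y* : [0,T] → ℝ^p be measurable functions such that all integrals below are finite. Let U₀ ∈ ℝ satisfy U₀ ≤ |x₀ − χ*|²_{P₂}, and define Ū := U₀ λ^T + ∫₀^T λ^{T−τ} ( |w(τ) − w*(τ)|²_Q + |y(τ) − y*(τ)|²_R ) dτ. Suppose the optimality inequality 2λ^T |χ* − x̂₀|²_{P₂} + ∫₀^T λ^{T−τ} ( 2|w*(τ)|²_Q + |y(τ) − y*(τ)|²_R ) dτ ≤ 2λ^T |x₀ − x̂₀|²_{P₂} + 2∫₀^T λ^{T−τ} |w(τ)|²_Q dτ holds. Then Ū ≤ 4λ^T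 |x₀ − x̂₀|²_{P₂} + 4∫₀^T λ^{T−τ} |w(τ)|²_Q dτ. -/
open MeasureTheory Matrix Set

/-- Quadratic norm `|v|²_M = vᵀ M v` associated with a matrix `M`. -/
noncomputable def qN {k : ℕ} (M : Matrix (Fin k) (Fin k) ℝ) (v : Fin k → ℝ) : ℝ :=
  v ⬝ᵥ (M *ᵥ v)

theorem qN_sub_le {k : ℕ} {M : Matrix (Fin k) (Fin k) ℝ} (hM : M.PosSemidef)
    (a b : Fin k → ℝ) : qN M (a - b) ≤ 2 * qN M a + 2 * qN M b := by
  have h : 0 ≤ qN M (a + b) := by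
    simpa [qN] using hM.dotProduct_mulVec_nonneg (a + b)
  have parallelogram : qN M (a + b) + qN M (a - b) = 2 * qN M a + 2 * qN M b := by
    simp only [qN, mulVec_add, mulVec_sub, dotProduct_add, dotProduct_sub, add_dotProduct,
      sub_dotProduct]
    ring
  linarith

/-- core cost bound in the proof of Proposition 2:
combining the prior bound, the definition of `Ū`, and the MHE optimality
inequality yields `Ū ≤ 4λ^T |x₀ − xhat₀|²_{P₂} + 4∫₀^T λ^{T−τ} |w(τ)|²_Q dτ`. -/
theorem mhe_cost_bound {n q p : ℕ}
    (T lam : ℝ) (hT : 0 < T) (hlam : lam ∈ Set.Ioo (0:ℝ) 1)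
    (P₂ : Matrix (Fin n) (Fin n) ℝ) (Q : Matrix (Fin q) (Fin q) ℝ)
    (R : Matrix (Fin p) (Fin p) ℝ)
    (hP₂ : P₂.PosDef) (hQ : Q.PosDef) (hR : R.PosDef)
    (x₀ xhat₀ χs : Fin n → ℝ)
    (w ws : ℝ → Fin q → ℝ) (y ys : ℝ → Fin p → ℝ)
    (hwm : Measurable w) (hwsm : Measurable ws)
    (hym : Measurable y) (hysm : Measurable ys)
    -- all integrals below are finite:
    (hint1 : IntervalIntegrable (fun τ => lam ^ (T - τ) * qN Q (w τ - ws τ)) volume 0 T)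
    (hint2 : IntervalIntegrable (fun τ => lam ^ (T - τ) * qN R (y τ - ys τ)) volume 0 T)
    (hint3 : IntervalIntegrable (fun τ => lam ^ (T - τ) * qN Q (ws τ)) volume 0 T)
    (hint4 : IntervalIntegrable (fun τ => lam ^ (T - τ) * qN Q (w τ)) volume 0 T)
    (U₀ : ℝ) (hU₀ : U₀ ≤ qN P₂ (x₀ - χs))
    (Ubar : ℝ)
    (hUbar : Ubar = U₀ * lam ^ T +
      ∫ τ in (0:ℝ)..T, lam ^ (T - τ) * (qN Q (w τ - ws τ) + qN R (y τ - ys τ)))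
    (hopt : 2 * lam ^ T * qN P₂ (χs - xhat₀) +
        (∫ τ in (0:ℝ)..T, lam ^ (T - τ) * (2 * qN Q (ws τ) + qN R (y τ - ys τ)))
      ≤ 2 * lam ^ T * qN P₂ (x₀ - xhat₀) +
        2 * ∫ τ in (0:ℝ)..T, lam ^ (T - τ) * qN Q (w τ)) :
    Ubar ≤ 4 * lam ^ T * qN P₂ (x₀ - xhat₀) +
      4 * ∫ τ in (0:ℝ)..T, lam ^ (T - τ) * qN Q (w τ) := by
  have hpow : 0 < lam ^ T := Real.rpow_pos_of_pos hlam.1 T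
  have hprior : U₀ ≤ 2 * qN P₂ (x₀ - xhat₀) + 2 * qN P₂ (χs - xhat₀) := by
    have h := qN_sub_le hP₂.posSemidef (x₀ - xhat₀) (χs - xhat₀)
    rw [sub_sub_sub_cancel_right] at h
    exact hU₀.trans h
  have hdist : (∫ τ in (0:ℝ)..T, lam ^ (T - τ) * qN Q (w τ - ws τ)) ≤
      2 * (∫ τ in (0:ℝ)..T, lam ^ (T - τ) * qN Q (w τ)) +
        2 * ∫ τ in (0:ℝ)..T, lam ^ (T - τ) * qN Q (ws τ) := by
    rw [← intervalIntegral.integral_const_mul, ← intervalIntegral.integral_const_mul,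
      ← intervalIntegral.integral_add (hint4.const_mul 2) (hint3.const_mul 2)]
    refine intervalIntegral.integral_mono_on hT.le hint1
      ((hint4.const_mul 2).add (hint3.const_mul 2)) fun τ _ => ?_
    have h := mul_le_mul_of_nonneg_left (qN_sub_le hQ.posSemidef (w τ) (ws τ))
      (Real.rpow_nonneg hlam.1.le (T - τ))
    linarith
  have hcost : (∫ τ in (0:ℝ)..T, lam ^ (T - τ) * (qN Q (w τ - ws τ) + qN R (y τ - ys τ))) =
      (∫ τ in (0:ℝ)..T, lam ^ (T - τ) * qN Q (w τ - ws τ)) +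
        ∫ τ in (0:ℝ)..T, lam ^ (T - τ) * qN R (y τ - ys τ) := by
    simp only [mul_add]
    exact intervalIntegral.integral_add hint1 hint2
  have hopt_cost :
      (∫ τ in (0:ℝ)..T, lam ^ (T - τ) * (2 * qN Q (ws τ) + qN R (y τ - ys τ))) =
      2 * (∫ τ in (0:ℝ)..T, lam ^ (T - τ) * qN Q (ws τ)) +
        ∫ τ in (0:ℝ)..T, lam ^ (T - τ) * qN R (y τ - ys τ) := by
    simp only [mul_add, mul_left_comm _ (2 : ℝ)]
    rw [intervalIntegral.integral_add (hint3.const_mul 2) hint2,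
      intervalIntegral.integral_const_mul]
  rw [hcost] at hUbar
  rw [hopt_cost] at hopt
  have hscaled := mul_le_mul_of_nonneg_right hprior hpow.le
  linarith
end

section
/- (Theorem 1, RGES of MHE, in abstract per-window-bound form.) Let T > 0, let 𝒯 ⊆ ℝ≥0 be a nonempty closed set that is unbounded above, and for t ≥ 0 define the associated sampling time k(t) := min{ s ∈ 𝒯 : s ≥ t }. Assume δ̄ := sup_{t≥0} (k(t) − t) satisfies δ̄ < T. Let λ, ρ ∈ (0,1) and μ ≥ 1 satisfy 4μ · λ^{T−δ̄} = ρ^{T−δ̄}. Let V, W : ℝ≥0 → ℝ≥0 satisfy W(t) ≤ μ V(t) for all t ≥ 0, and let g : ℝ≥0 → ℝ≥0 be integrable on every bounded interval. Suppose that for every t ≥ 0, with t_i := k(t) and T_i := min(t_i, T), the per-window bound V(t) ≤ λ^{−(t_i − t)} ( 4 λ^{T_i} W(t_i − T_i) + 4∫_{t_i − T_i}^{t_i} λ^{t_i − τ} g(τ) dτ ) holds. Then for every t_i ∈ 𝒯: V(t_i) ≤ 4 ρ^{t_i} W(0) + 8∫₀^{t_i} ρ^{t_i − τ} g(τ) dτ.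 -/
open MeasureTheory Set

/-- The sampling time associated with `t`: the smallest element of `𝒯` that is `≥ t`. -/
noncomputable def samplingTime (𝒯 : Set ℝ) (t : ℝ) : ℝ :=
  sInf {s | s ∈ 𝒯 ∧ t ≤ s}

section SamplingTime

variable {𝒯 : Set ℝ}

lemma samplingTime_mem_and_le (hcl : IsClosed 𝒯) (hub : ¬ BddAbove 𝒯) (t : ℝ) :
    samplingTime 𝒯 t ∈ 𝒯 ∧ t ≤ samplingTime 𝒯 t := by
  have hne : {s | s ∈ 𝒯 ∧ t ≤ s}.Nonempty := by
    obtain ⟨s, hs, hts⟩ := not_bddAbove_iff.1 hub t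
    exact ⟨s, hs, hts.le⟩
  have hbdd : BddBelow {s | s ∈ 𝒯 ∧ t ≤ s} := ⟨t, fun s hs => hs.2⟩
  exact (hcl.inter isClosed_Ici).csInf_mem hne hbdd

lemma samplingTime_le {s t : ℝ} (hs : s ∈ 𝒯) (hts : t ≤ s) : samplingTime 𝒯 t ≤ s :=
  csInf_le ⟨t, fun _ hu => hu.2⟩ ⟨hs, hts⟩

lemma samplingTime_eq_self (hcl : IsClosed 𝒯) (hub : ¬ BddAbove 𝒯) {s : ℝ} (hs : s ∈ 𝒯) :
    samplingTime 𝒯 s = s :=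
  le_antisymm (samplingTime_le hs le_rfl) (samplingTime_mem_and_le hcl hub s).2

end SamplingTime

section DiscountedIntegral

variable {g : ℝ → ℝ}

lemma intervalIntegrable_rpow_sub_mul (hg : ∀ a b : ℝ, IntervalIntegrable g volume a b)
    {c : ℝ} (hc : 0 < c) (s a b : ℝ) :
    IntervalIntegrable (fun τ => c ^ (s - τ) * g τ) volume a b := by
  have hcont : Continuous fun τ : ℝ => c ^ (s - τ) :=
    (Real.continuous_const_rpow hc.ne').comp (continuous_const.sub continuous_id)
  exact (hg a b).continuousOn_mul hcont.continuousOn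

lemma integral_rpow_sub_mul {c : ℝ} (hc : 0 < c) (s a b : ℝ) :
    ∫ τ in a..b, c ^ (s - τ) * g τ = c ^ s * ∫ τ in a..b, c ^ (0 - τ) * g τ := by
  rw [← intervalIntegral.integral_const_mul]
  congr 1
  ext τ
  rw [← mul_assoc, ← Real.rpow_add hc]
  ring_nf

lemma integral_rpow_sub_mul_mono (hg0 : ∀ τ, 0 ≤ g τ)
    (hg : ∀ a b : ℝ, IntervalIntegrable g volume a b) {c : ℝ} (hc : 0 < c) (s a : ℝ) :
    Monotone fun b => ∫ τ in a..b, c ^ (s - τ) * g τ := by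
  intro b b' hbb'
  have hint := intervalIntegrable_rpow_sub_mul hg hc s
  have hsplit := intervalIntegral.integral_add_adjacent_intervals (hint a b) (hint b b')
  have hnonneg : 0 ≤ ∫ τ in b..b', c ^ (s - τ) * g τ :=
    intervalIntegral.integral_nonneg hbb' fun τ _ =>
      mul_nonneg (Real.rpow_nonneg hc.le _) (hg0 τ)
  dsimp only
  linarith

/-- Replacing the discount factor of a window ending at `s` by a larger one. -/
lemma integral_rpow_sub_mul_le_s7 (hg0 : ∀ τ, 0 ≤ g τ)
    (hg : ∀ a b : ℝ, IntervalIntegrable g volume a b) {c d : ℝ} (hc : 0 < c) (hcd : c ≤ d)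
    {s a : ℝ} (has : a ≤ s) :
    ∫ τ in a..s, c ^ (s - τ) * g τ ≤
      d ^ s * ((∫ τ in (0:ℝ)..s, d ^ (0 - τ) * g τ) - ∫ τ in (0:ℝ)..a, d ^ (0 - τ) * g τ) := by
  have hd : 0 < d := hc.trans_le hcd
  have hint := intervalIntegrable_rpow_sub_mul hg hd 0
  rw [intervalIntegral.integral_interval_sub_left (hint 0 s) (hint 0 a),
    ← integral_rpow_sub_mul hd]
  refine intervalIntegral.integral_mono_on has (intervalIntegrable_rpow_sub_mul hg hc s a s)
    (intervalIntegrable_rpow_sub_mul hg hd s a s) fun τ hτ => ?_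
  exact mul_le_mul_of_nonneg_right
    (Real.rpow_le_rpow hc.le hcd (sub_nonneg.2 hτ.2)) (hg0 τ)

end DiscountedIntegral

section Contraction

variable {c d μ L δ : ℝ}

lemma le_of_mul_rpow_eq_rpow (hc : 0 < c) (hd : 0 < d) (hμ : 1 ≤ μ) (hL : 0 < L)
    (h : μ * c ^ L = d ^ L) : c ≤ d := by
  rw [← Real.rpow_le_rpow_iff hc.le hd.le hL, ← h]
  exact le_mul_of_one_le_left (Real.rpow_nonneg hc.le _) hμ

lemma mul_rpow_le_rpow_of_le (hc : 0 < c) (hcd : c ≤ d) (h : μ * c ^ L = d ^ L) (hLδ : L ≤ δ) :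
    μ * c ^ δ ≤ d ^ δ := by
  have hd : 0 < d := hc.trans_le hcd
  have hδ : δ = L + (δ - L) := by ring
  rw [hδ, Real.rpow_add hc, Real.rpow_add hd, ← mul_assoc, h]
  exact mul_le_mul_of_nonneg_left
    (Real.rpow_le_rpow hc.le hcd (sub_nonneg.2 hLδ)) (Real.rpow_nonneg hd.le _)

end Contraction

/-- Theorem 1, RGES of MHE, abstract per-window-bound form:
if the per-window contraction bound holds for every `t ≥ 0` (with window length
`T_i = min(k(t), T)` ending at the sampling time `t_i = k(t)`), and the horizon
satisfies `4μ λ^{T−δ̄} = ρ^{T−δ̄}` with `δ̄ = sup_{t≥0}(k(t)−t) < T`, then at every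
sampling time `t_i ∈ 𝒯` we have
`V(t_i) ≤ 4 ρ^{t_i} W(0) + 8 ∫₀^{t_i} ρ^{t_i−τ} g(τ) dτ`. -/
theorem mhe_rges (T : ℝ) (hT : 0 < T)
    (𝒯 : Set ℝ) (h𝒯ne : 𝒯.Nonempty) (h𝒯cl : IsClosed 𝒯)
    (h𝒯ub : ¬ BddAbove 𝒯) (h𝒯pos : 𝒯 ⊆ Set.Ici 0)
    (δbar : ℝ)
    (hδlub : IsLUB {d : ℝ | ∃ t, 0 ≤ t ∧ d = samplingTime 𝒯 t - t} δbar)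
    (hδT : δbar < T)
    (lam ρ μ : ℝ) (hlam : lam ∈ Set.Ioo (0:ℝ) 1) (hρ : ρ ∈ Set.Ioo (0:ℝ) 1)
    (hμ : 1 ≤ μ)
    (hdesign : 4 * μ * lam ^ (T - δbar) = ρ ^ (T - δbar))
    (V W : ℝ → ℝ) (hV0 : ∀ t, 0 ≤ V t) (hW0 : ∀ t, 0 ≤ W t)
    (hWV : ∀ t, 0 ≤ t → W t ≤ μ * V t)
    (g : ℝ → ℝ) (hg0 : ∀ τ, 0 ≤ g τ)
    (hgint : ∀ a b : ℝ, IntervalIntegrable g volume a b)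
    (hwin : ∀ t, 0 ≤ t →
      V t ≤ lam ^ (-(samplingTime 𝒯 t - t)) *
        (4 * lam ^ (min (samplingTime 𝒯 t) T) *
            W (samplingTime 𝒯 t - min (samplingTime 𝒯 t) T) +
          4 * ∫ τ in (samplingTime 𝒯 t - min (samplingTime 𝒯 t) T)..(samplingTime 𝒯 t),
            lam ^ (samplingTime 𝒯 t - τ) * g τ)) :
    ∀ tᵢ ∈ 𝒯, V tᵢ ≤ 4 * ρ ^ tᵢ * W 0 + 8 * ∫ τ in (0:ℝ)..tᵢ, ρ ^ (tᵢ - τ) * g τ := by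
  obtain ⟨hl0, -⟩ := hlam
  obtain ⟨hρ0, -⟩ := hρ
  have hL : 0 < T - δbar := sub_pos.2 hδT
  have hlρ : lam ≤ ρ := le_of_mul_rpow_eq_rpow hl0 hρ0 (by linarith) hL hdesign
  have hk := samplingTime_mem_and_le h𝒯cl h𝒯ub
  set F : ℝ → ℝ := fun s => 4 * lam ^ (min s T) * W (s - min s T) +
    4 * ∫ τ in (s - min s T)..s, lam ^ (s - τ) * g τ with hF
  set I : ℝ → ℝ := fun b => ∫ τ in (0:ℝ)..b, ρ ^ (0 - τ) * g τ with hI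
  have hImono : Monotone I := integral_rpow_sub_mul_mono hg0 hgint hρ0 0 0
  have hI0 : I 0 = 0 := intervalIntegral.integral_same
  have hVF : ∀ t, 0 ≤ t → V t ≤ lam ^ (-(samplingTime 𝒯 t - t)) * F (samplingTime 𝒯 t) := hwin
  have hwindow : ∀ a s, a ≤ s → ∫ τ in a..s, lam ^ (s - τ) * g τ ≤ ρ ^ s * (I s - I a) :=
    fun a s has => integral_rpow_sub_mul_le_s7 hg0 hgint hl0 hlρ has
  -- The windows visited by the recursion overlap at most twice: besides the integral up to `s`,
  -- a second one up to any bound `r` of the sampling times before `s` suffices.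
  have key : ∀ n : ℕ, ∀ s ∈ 𝒯, s ≤ n * (T - δbar) → ∀ r, 0 ≤ r → (∀ u ∈ 𝒯, u < s → u ≤ r) →
      F s ≤ ρ ^ s * (4 * W 0 + 4 * I s + 4 * I r) := by
    have base : ∀ s ∈ 𝒯, s ≤ T → ∀ r, 0 ≤ r →
        F s ≤ ρ ^ s * (4 * W 0 + 4 * I s + 4 * I r) := by
      intro s hs hsT r hr
      have hs0 : 0 ≤ s := h𝒯pos hs
      have hw := hwindow 0 s hs0
      have hpow := mul_le_mul_of_nonneg_right (Real.rpow_le_rpow hl0.le hlρ hs0) (hW0 0)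
      have hIr : 0 ≤ ρ ^ s * I r :=
        mul_nonneg (Real.rpow_nonneg hρ0.le _) (hI0 ▸ hImono hr)
      simp only [hF, min_eq_left hsT, sub_self]
      rw [hI0] at hw
      linarith
    intro n
    induction n with
    | zero =>
      intro s hs hsn r hr _
      refine base s hs ?_ r hr
      push_cast at hsn
      linarith
    | succ n ih =>
      intro s hs hsn r hr hur
      rcases le_or_gt s T with hsT | hsT
      · exact base s hs hsT r hr
      have ht0 : 0 ≤ s - T := by linarith
      obtain ⟨hs'mem, hts'⟩ := hk (s - T)
      have hVt := hVF (s - T) ht0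
      have hδ : samplingTime 𝒯 (s - T) - (s - T) ≤ δbar := hδlub.1 ⟨s - T, ht0, rfl⟩
      have hmin : ∀ u ∈ 𝒯, u < samplingTime 𝒯 (s - T) → u ≤ s - T := fun u hu hlt =>
        (not_le.1 fun h => hlt.not_ge (samplingTime_le hu h)).le
      set s' := samplingTime 𝒯 (s - T) with hs'
      have hs's : s' < s := by linarith
      have hF' := ih s' hs'mem (by push_cast at hsn; linarith) (s - T) ht0 hmin
      have hFnonneg : 0 ≤ F s' := by
        have h := (hV0 s').trans (hVF s' (h𝒯pos hs'mem))
        rwa [samplingTime_eq_self h𝒯cl h𝒯ub hs'mem, sub_self, neg_zero, Real.rpow_zero,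
          one_mul] at h
      have hcontr : 4 * μ * lam ^ (s - s') ≤ ρ ^ (s - s') :=
        mul_rpow_le_rpow_of_le hl0 hlρ hdesign (by linarith)
      have hprev : 4 * lam ^ T * W (s - T) ≤
          ρ ^ s * (4 * W 0 + 4 * I s' + 4 * I (s - T)) :=
        calc 4 * lam ^ T * W (s - T)
            ≤ 4 * lam ^ T * (μ * (lam ^ (-(s' - (s - T))) * F s')) := by
              have := (hWV _ ht0).trans (mul_le_mul_of_nonneg_left hVt (by linarith : 0 ≤ μ))
              exact mul_le_mul_of_nonneg_left this (by positivity)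
          _ = 4 * μ * lam ^ (s - s') * F s' := by
              have : s - s' = T + -(s' - (s - T)) := by ring
              rw [this, Real.rpow_add hl0]
              ring
          _ ≤ ρ ^ (s - s') * F s' := mul_le_mul_of_nonneg_right hcontr hFnonneg
          _ ≤ ρ ^ (s - s') * (ρ ^ s' * (4 * W 0 + 4 * I s' + 4 * I (s - T))) :=
              mul_le_mul_of_nonneg_left hF' (Real.rpow_nonneg hρ0.le _)
          _ = ρ ^ s * (4 * W 0 + 4 * I s' + 4 * I (s - T)) := by
              rw [← mul_assoc, ← Real.rpow_add hρ0, sub_add_cancel]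
      have hw := hwindow (s - T) s (by linarith)
      have hIr : ρ ^ s * I s' ≤ ρ ^ s * I r :=
        mul_le_mul_of_nonneg_left (hImono (hur s' hs'mem hs's)) (Real.rpow_nonneg hρ0.le _)
      simp only [hF, min_eq_right hsT.le]
      linarith
  intro s hs
  obtain ⟨n, hn⟩ := exists_nat_ge (s / (T - δbar))
  have hFs := key n s hs ((div_le_iff₀ hL).1 hn) s (h𝒯pos hs) fun u _ hu => hu.le
  have hVs := hVF s (h𝒯pos hs)
  rw [samplingTime_eq_self h𝒯cl h𝒯ub hs, sub_self, neg_zero, Real.rpow_zero, one_mul] at hVs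
  rw [integral_rpow_sub_mul hρ0]
  change V s ≤ 4 * ρ ^ s * W 0 + 8 * (ρ ^ s * I s)
  linarith
end

section
/- (Time-varying linear differential dissipation; analytic core of Theorem 2.) Let A : ℝ → ℝ^{n×n}, B : ℝ → ℝ^{n×q}, C : ℝ → ℝ^{p×n}, D : ℝ → ℝ^{p×q} be continuous matrix-valued functions, let P ∈ ℝ^{n×n}, Q ∈ ℝ^{q×q}, R ∈ ℝ^{p×p} be symmetric positive definite, and let κ > 0. Suppose that for every t ≥ 0 the block matrix [[P A(t) + A(t)ᵀ P + κP − C(t)ᵀ R C(t), P B(t) − C(t)ᵀ R D(t)], [B(t)ᵀ P − D(t)ᵀ R C(t), −D(t)ᵀ R D(t) − Q]] is negative semidefinite. Let δw : ℝ → ℝ^q be continuous and let δx : ℝ → ℝⁿ be differentiable with δx'(t) = A(t) δx(t) + B(t) δw(t) for all t ≥ 0. Then for all t ≥ 0: |δx(t)|²_P ≤ e^{−κt} |δx(0)|²_P + ∫₀^t e^{−κ(t−τ)} ( |δw(τ)|²_Q + |C(τ) δx(τ) + D(τ) δw(τ)|²_R ) dτ. -/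
open MeasureTheory Matrix Set

theorem Continuous.qN {k : ℕ} {X : Type*} [TopologicalSpace X]
    (M : Matrix (Fin k) (Fin k) ℝ) {v : X → Fin k → ℝ} (hv : Continuous v) :
    Continuous fun x => qN M (v x) :=
  hv.dotProduct (continuous_const.matrix_mulVec hv)

theorem HasDerivAt.dotProduct {k : ℕ} {u v : ℝ → Fin k → ℝ} {u' v' : Fin k → ℝ} {t : ℝ}
    (hu : HasDerivAt u u' t) (hv : HasDerivAt v v' t) :
    HasDerivAt (fun s => u s ⬝ᵥ v s) (u' ⬝ᵥ v t + u t ⬝ᵥ v') t := by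
  rw [hasDerivAt_pi] at hu hv
  simp only [_root_.dotProduct, ← Finset.sum_add_distrib]
  exact HasDerivAt.fun_sum fun i _ => (hu i).mul (hv i)

theorem HasDerivAt.const_mulVec {k : ℕ} (M : Matrix (Fin k) (Fin k) ℝ)
    {v : ℝ → Fin k → ℝ} {v' : Fin k → ℝ} {t : ℝ} (hv : HasDerivAt v v' t) :
    HasDerivAt (fun s => M *ᵥ v s) (M *ᵥ v') t :=
  hasDerivAt_pi.2 fun i => by
    have h := (hasDerivAt_const t (M i)).dotProduct hv
    rw [zero_dotProduct, zero_add] at h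
    exact h

theorem HasDerivAt.qN {k : ℕ} (M : Matrix (Fin k) (Fin k) ℝ)
    {v : ℝ → Fin k → ℝ} {v' : Fin k → ℝ} {t : ℝ} (hv : HasDerivAt v v' t) :
    HasDerivAt (fun s => qN M (v s)) (v' ⬝ᵥ (M *ᵥ v t) + v t ⬝ᵥ (M *ᵥ v')) t :=
  hv.dotProduct (hv.const_mulVec M)

/-- The quadratic form of the dissipation matrix is the storage rate minus the supply rate. -/
theorem dotProduct_fromBlocks_mulVec_eq {n q p : ℕ}
    (A : Matrix (Fin n) (Fin n) ℝ) (B : Matrix (Fin n) (Fin q) ℝ)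
    (C : Matrix (Fin p) (Fin n) ℝ) (D : Matrix (Fin p) (Fin q) ℝ)
    (P : Matrix (Fin n) (Fin n) ℝ) (Q : Matrix (Fin q) (Fin q) ℝ)
    (R : Matrix (Fin p) (Fin p) ℝ) (κ : ℝ) (x : Fin n → ℝ) (w : Fin q → ℝ) :
    Sum.elim x w ⬝ᵥ ((Matrix.fromBlocks
        (P * A + Aᵀ * P + κ • P - Cᵀ * R * C) (P * B - Cᵀ * R * D)
        (Bᵀ * P - Dᵀ * R * C) (-(Dᵀ * R * D) - Q)) *ᵥ Sum.elim x w) =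
      (A *ᵥ x + B *ᵥ w) ⬝ᵥ (P *ᵥ x) + x ⬝ᵥ (P *ᵥ (A *ᵥ x + B *ᵥ w)) + κ * qN P x -
        (qN Q w + qN R (C *ᵥ x + D *ᵥ w)) := by
  have transpose_form {a b : ℕ} (M : Matrix (Fin a) (Fin b) ℝ) (u : Fin b → ℝ)
      (v : Fin a → ℝ) : u ⬝ᵥ (Mᵀ *ᵥ v) = (M *ᵥ u) ⬝ᵥ v := by
    rw [dotProduct_mulVec, vecMul_transpose]
  simp only [qN, fromBlocks_mulVec, sumElim_dotProduct_sumElim, Sum.elim_comp_inl,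
    Sum.elim_comp_inr, add_mulVec, sub_mulVec, neg_mulVec, smul_mulVec, ← mulVec_mulVec,
    dotProduct_add, dotProduct_sub, dotProduct_neg, dotProduct_smul, add_dotProduct,
    mulVec_add, transpose_form, smul_eq_mul]
  ring

/-- time-varying linear differential dissipation; analytic core of
Theorem 2: if the pointwise LMI holds along `t ≥ 0` and `δx' = A δx + B δw`,
then `|δx(t)|²_P ≤ e^{−κt}|δx(0)|²_P + ∫₀^t e^{−κ(t−τ)}(|δw|²_Q + |Cδx + Dδw|²_R) dτ`. -/
theorem time_varying_dissipation {n q p : ℕ}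
    (A : ℝ → Matrix (Fin n) (Fin n) ℝ) (B : ℝ → Matrix (Fin n) (Fin q) ℝ)
    (C : ℝ → Matrix (Fin p) (Fin n) ℝ) (D : ℝ → Matrix (Fin p) (Fin q) ℝ)
    (hA : Continuous A) (hB : Continuous B) (hC : Continuous C) (hD : Continuous D)
    (P : Matrix (Fin n) (Fin n) ℝ) (Q : Matrix (Fin q) (Fin q) ℝ)
    (R : Matrix (Fin p) (Fin p) ℝ)
    (hP : P.PosDef) (hQ : Q.PosDef) (hR : R.PosDef)
    (κ : ℝ) (hκ : 0 < κ)
    (hLMI : ∀ t, 0 ≤ t → ∀ z : (Fin n ⊕ Fin q) → ℝ,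
      z ⬝ᵥ ((Matrix.fromBlocks
        (P * A t + (A t)ᵀ * P + κ • P - (C t)ᵀ * R * C t)
        (P * B t - (C t)ᵀ * R * D t)
        ((B t)ᵀ * P - (D t)ᵀ * R * C t)
        (-((D t)ᵀ * R * D t) - Q)) *ᵥ z) ≤ 0)
    (δw : ℝ → Fin q → ℝ) (hδw : Continuous δw)
    (δx : ℝ → Fin n → ℝ)
    (hδx : ∀ t, 0 ≤ t → HasDerivAt δx (A t *ᵥ δx t + B t *ᵥ δw t) t) :
    ∀ t, 0 ≤ t →
      qN P (δx t) ≤ Real.exp (-κ * t) * qN P (δx 0) +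
        ∫ τ in (0:ℝ)..t, Real.exp (-κ * (t - τ)) *
          (qN Q (δw τ) + qN R (C τ *ᵥ δx τ + D τ *ᵥ δw τ)) := by
  intro t ht
  have hx : ContinuousOn δx (Icc 0 t) := fun s hs => (hδx s hs.1).continuousAt.continuousWithinAt
  have hderiv (s : ℝ) (hs : 0 ≤ s) :=
    ((((hasDerivAt_id s).const_sub t).const_mul (-κ)).exp).mul ((hδx s hs).qN P)
  have hV : ContinuousOn (fun τ => Real.exp (-κ * (t - τ)) * qN P (δx τ)) (Icc 0 t) :=
    fun s hs => (hderiv s hs.1).continuousAt.continuousWithinAt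
  have hsupply : ContinuousOn (fun τ => Real.exp (-κ * (t - τ)) *
      (qN Q (δw τ) + qN R (C τ *ᵥ δx τ + D τ *ᵥ δw τ))) (Icc 0 t) := by
    rw [continuousOn_iff_continuous_domRestrict] at hx ⊢
    have hval : Continuous ((↑) : Icc 0 t → ℝ) := continuous_subtype_val
    exact (Real.continuous_exp.comp (continuous_const.mul (continuous_const.sub hval))).mul
      (((hδw.comp hval).qN Q).add ((((hC.comp hval).matrix_mulVec hx).add
        ((hD.comp hval).matrix_mulVec (hδw.comp hval))).qN R))
  have key := intervalIntegral.sub_le_integral_of_hasDeriv_right_of_le ht hV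
    (fun s hs => (hderiv s hs.1.le).hasDerivWithinAt) hsupply.integrableOn_Icc
    (fun s hs => by
      have h := hLMI s hs.1.le (Sum.elim (δx s) (δw s))
      rw [dotProduct_fromBlocks_mulVec_eq] at h
      have := mul_le_mul_of_nonneg_left (sub_nonpos.1 h) (Real.exp_pos (-κ * (t - s))).le
      simp only [id] at this ⊢
      linarith)
  simp only [sub_self, mul_zero, Real.exp_zero, one_mul, sub_zero] at key
  linarith
end

section
/- (RGAS of full information estimation, abstracted; Remark 6.) Let α₁, α₂, σ_w, σ_y : ℝ≥0 → ℝ≥0 be nondecreasing with α₂(0) ≥ 0, and let λ ∈ (0,1). Let U : ℝⁿ × ℝⁿ → ℝ≥0 satisfy α₁(|a−b|) ≤ U(a,b) ≤ α₂(|a−b|) for all a,b ∈ ℝⁿ. Let t ≥ 0, let x, x̄* : [0,t] → ℝⁿ, w, w* : [0,t] → ℝ^q, y, y* : [0,t] → ℝ^p be functions (with all integrals below finite), let χ := x(0), χ* := x̄*(0), x̂(t) := x̄*(t), and let χ̂ ∈ ℝⁿ be the prior estimate. Assume: (i) the dissipation inequality U(x(t), x̄*(t)) ≤ U(χ, χ*)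 λ^t + ∫₀^t λ^{t−τ} ( σ_w(|w(τ)−w*(τ)|) + σ_y(|y(τ)−y*(τ)|) ) dτ; and (ii) the optimality inequality α₂(2|χ* − χ̂|) λ^t + ∫₀^t λ^{t−τ} ( σ_w(2|w*(τ)|) + σ_y(|y(τ)−y*(τ)|) ) dτ ≤ α₂(2|χ − χ̂|) λ^t + ∫₀^t λ^{t−τ} σ_w(2|w(τ)|) dτ. Then α₁(|x(t) − x̂(t)|) ≤ 2 λ^t α₂(2|χ − χ̂|) + 2∫₀^t λ^{t−τ} σ_w(2|w(τ)|) dτ. -/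
open MeasureTheory Set

/-- Weak triangle inequality for a nonnegative gain that is nondecreasing on `[0, ∞)`. -/
theorem gain_norm_sub_le_add {E : Type*} [SeminormedAddCommGroup E] {f : ℝ → ℝ}
    (hmono : ∀ s₁ s₂ : ℝ, 0 ≤ s₁ → s₁ ≤ s₂ → f s₁ ≤ f s₂) (hnonneg : ∀ s, 0 ≤ s → 0 ≤ f s)
    (a b c : E) : f ‖a - b‖ ≤ f (2 * ‖a - c‖) + f (2 * ‖b - c‖) := by
  have htri : ‖a - b‖ ≤ ‖a - c‖ + ‖b - c‖ := by
    simpa [norm_sub_rev] using norm_sub_le_norm_sub_add_norm_sub a c b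
  have ha := hnonneg (2 * ‖a - c‖) (by positivity)
  have hb := hnonneg (2 * ‖b - c‖) (by positivity)
  rcases le_total ‖a - c‖ ‖b - c‖ with h | h
  · linarith [hmono ‖a - b‖ (2 * ‖b - c‖) (norm_nonneg _) (by linarith)]
  · linarith [hmono ‖a - b‖ (2 * ‖a - c‖) (norm_nonneg _) (by linarith)]

/-- RGAS of full information estimation, abstracted; Remark 6:
the dissipation inequality along the optimal FIE trajectory combined with the
optimality inequality yields
`α₁(|x(t) − x̂(t)|) ≤ 2λ^t α₂(2|χ − χ̂|) + 2∫₀^t λ^{t−τ} σ_w(2|w(τ)|) dτ`. -/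
theorem fie_rgas {n q p : ℕ}
    (α₁ α₂ σw σy : ℝ → ℝ)
    (hα₁mono : ∀ s₁ s₂ : ℝ, 0 ≤ s₁ → s₁ ≤ s₂ → α₁ s₁ ≤ α₁ s₂)
    (hα₂mono : ∀ s₁ s₂ : ℝ, 0 ≤ s₁ → s₁ ≤ s₂ → α₂ s₁ ≤ α₂ s₂)
    (hσwmono : ∀ s₁ s₂ : ℝ, 0 ≤ s₁ → s₁ ≤ s₂ → σw s₁ ≤ σw s₂)
    (hσymono : ∀ s₁ s₂ : ℝ, 0 ≤ s₁ → s₁ ≤ s₂ → σy s₁ ≤ σy s₂)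
    (hα₁0 : ∀ s, 0 ≤ s → 0 ≤ α₁ s) (hα₂0 : ∀ s, 0 ≤ s → 0 ≤ α₂ s)
    (hσw0 : ∀ s, 0 ≤ s → 0 ≤ σw s) (hσy0 : ∀ s, 0 ≤ s → 0 ≤ σy s)
    (hα₂zero : 0 ≤ α₂ 0)
    (lam : ℝ) (hlam : lam ∈ Set.Ioo (0:ℝ) 1)
    (U : EuclideanSpace ℝ (Fin n) → EuclideanSpace ℝ (Fin n) → ℝ)
    (hU0 : ∀ a b, 0 ≤ U a b)
    (hUbnd : ∀ a b, α₁ ‖a - b‖ ≤ U a b ∧ U a b ≤ α₂ ‖a - b‖)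
    (t : ℝ) (ht : 0 ≤ t)
    (x xbs : ℝ → EuclideanSpace ℝ (Fin n))
    (w ws : ℝ → EuclideanSpace ℝ (Fin q))
    (y ys : ℝ → EuclideanSpace ℝ (Fin p))
    (χhat : EuclideanSpace ℝ (Fin n))
    -- all integrals below are finite:
    (hint1 : IntervalIntegrable
      (fun τ => lam ^ (t - τ) * (σw ‖w τ - ws τ‖ + σy ‖y τ - ys τ‖)) volume 0 t)
    (hint2 : IntervalIntegrable
      (fun τ => lam ^ (t - τ) * (σw (2 * ‖ws τ‖) + σy ‖y τ - ys τ‖)) volume 0 t)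
    (hint3 : IntervalIntegrable (fun τ => lam ^ (t - τ) * σw (2 * ‖w τ‖)) volume 0 t)
    (hint4 : IntervalIntegrable (fun τ => lam ^ (t - τ) * σw (2 * ‖ws τ‖)) volume 0 t)
    (hint5 : IntervalIntegrable (fun τ => lam ^ (t - τ) * σy ‖y τ - ys τ‖) volume 0 t)
    -- (i) dissipation inequality:
    (hdiss : U (x t) (xbs t) ≤ U (x 0) (xbs 0) * lam ^ t +
      ∫ τ in (0:ℝ)..t, lam ^ (t - τ) * (σw ‖w τ - ws τ‖ + σy ‖y τ - ys τ‖))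
    -- (ii) optimality inequality:
    (hopt : α₂ (2 * ‖xbs 0 - χhat‖) * lam ^ t +
        (∫ τ in (0:ℝ)..t, lam ^ (t - τ) * (σw (2 * ‖ws τ‖) + σy ‖y τ - ys τ‖))
      ≤ α₂ (2 * ‖x 0 - χhat‖) * lam ^ t +
        ∫ τ in (0:ℝ)..t, lam ^ (t - τ) * σw (2 * ‖w τ‖)) :
    α₁ ‖x t - xbs t‖ ≤ 2 * lam ^ t * α₂ (2 * ‖x 0 - χhat‖) +
      2 * ∫ τ in (0:ℝ)..t, lam ^ (t - τ) * σw (2 * ‖w τ‖) := by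
  have hpow (s : ℝ) : 0 ≤ lam ^ s := Real.rpow_nonneg hlam.1.le s
  have hinit : U (x 0) (xbs 0) * lam ^ t ≤
      (α₂ (2 * ‖x 0 - χhat‖) + α₂ (2 * ‖xbs 0 - χhat‖)) * lam ^ t :=
    mul_le_mul_of_nonneg_right
      ((hUbnd _ _).2.trans (gain_norm_sub_le_add hα₂mono hα₂0 _ _ _)) (hpow t)
  have hdist : (∫ τ in (0:ℝ)..t, lam ^ (t - τ) * (σw ‖w τ - ws τ‖ + σy ‖y τ - ys τ‖)) ≤
      (∫ τ in (0:ℝ)..t, lam ^ (t - τ) * σw (2 * ‖w τ‖)) +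
        ∫ τ in (0:ℝ)..t, lam ^ (t - τ) * (σw (2 * ‖ws τ‖) + σy ‖y τ - ys τ‖) := by
    rw [← intervalIntegral.integral_add hint3 hint2]
    refine intervalIntegral.integral_mono_on ht hint1 (hint3.add hint2) fun τ _ => ?_
    have hw : σw ‖w τ - ws τ‖ ≤ σw (2 * ‖w τ‖) + σw (2 * ‖ws τ‖) := by
      simpa using gain_norm_sub_le_add hσwmono hσw0 (w τ) (ws τ) 0
    rw [← mul_add]
    exact mul_le_mul_of_nonneg_left (by linarith) (hpow _)
  linarith [(hUbnd (x t) (xbs t)).1]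
end
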